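/- arXiv:2406.19725 — 3 statements merged into one kernel-verified Lean document; each statement's English description precedes it below -/
import Mathlib

section
/- Let R be a ring, M a left R-module, and n ≥ 2 a natural number. Regard the n×n matrices Matrix (Fin n) (Fin n) M as a left module over the matrix ring Matrix (Fin n) (Fin n) R via (A • K) i j = ∑_k A i k • K k j. Then every element of Matrix (Fin n) (Fin n) M is nilpotent, i.e., Nil_{M_n(R)}(M_n(M)) = M_n(M). -/
/-- An element `m` of a left `R`-module `M` is nilpotent if `m = 0` or there are `r : R`
and `k : ℕ` with `r ^ k • m = 0` but `r • m ≠ 0`. -/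
def IsNilElem (R : Type*) {M : Type*} [Ring R] [AddCommGroup M] [Module R M] (m : M) : Prop :=
  m = 0 ∨ ∃ (r : R) (k : ℕ), r ^ k • m = 0 ∧ r • m ≠ 0

/-- `n × n` matrices over a ring `R` act on `n × n` matrices over a left `R`-module `M`
by matrix multiplication: `(A • K) i j = ∑ k, A i k • K k j`. -/
instance Matrix.moduleSMul {n : ℕ} {R M : Type*} [Ring R] [AddCommGroup M] [Module R M] :
    SMul (Matrix (Fin n) (Fin n) R) (Matrix (Fin n) (Fin n) M) :=
  ⟨fun A K => Matrix.of fun i j => ∑ k, A i k • K k j⟩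

theorem Matrix.moduleSMul_apply {n : ℕ} {R M : Type*} [Ring R] [AddCommGroup M] [Module R M]
    (A : Matrix (Fin n) (Fin n) R) (K : Matrix (Fin n) (Fin n) M) (i j : Fin n) :
    (A • K) i j = ∑ k, A i k • K k j := rfl

/-- `Matrix (Fin n) (Fin n) M` is a left module over the matrix ring `Matrix (Fin n) (Fin n) R`. -/
instance Matrix.moduleMatrix {n : ℕ} {R M : Type*} [Ring R] [AddCommGroup M] [Module R M] :
    Module (Matrix (Fin n) (Fin n) R) (Matrix (Fin n) (Fin n) M) where
  one_smul K := by
    ext i j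
    simp only [Matrix.moduleSMul_apply]
    simp [Matrix.one_apply, ite_smul]
  mul_smul A B K := by
    ext i j
    simp only [Matrix.moduleSMul_apply, Matrix.mul_apply, Finset.sum_smul,
      Finset.smul_sum]
    rw [Finset.sum_comm]
    simp only [SemigroupAction.mul_smul]
  smul_zero A := by
    ext i j
    simp only [Matrix.moduleSMul_apply, Matrix.zero_apply]
    simp
  smul_add A K L := by
    ext i j
    simp only [Matrix.moduleSMul_apply, Matrix.add_apply]
    simp only [DistribSMul.smul_add, Finset.sum_add_distrib]
  add_smul A B K := by
    ext i j
    simp only [Matrix.moduleSMul_apply, Matrix.add_apply]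
    simp only [Module.add_smul, Finset.sum_add_distrib]
  zero_smul K := by
    ext i j
    simp only [Matrix.moduleSMul_apply, Matrix.zero_apply]
    simp

theorem matrix_module_all_nilElem {n : ℕ} {R M : Type*} [Ring R] [AddCommGroup M] [Module R M]
    (hn : 2 ≤ n) :
    ∀ K : Matrix (Fin n) (Fin n) M, IsNilElem (Matrix (Fin n) (Fin n) R) K := by
  intro K
  by_cases hK : K = 0
  · exact Or.inl hK
  right
  have hab : ∃ a b, K a b ≠ 0 := by
    by_contra hcon
    apply hK
    ext a b
    by_contra hne
    exact hcon ⟨a, b, hne⟩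
  obtain ⟨a, b, hab⟩ := hab
  have : Nontrivial (Fin n) := Fin.nontrivial_iff_two_le.mpr hn
  obtain ⟨c, hc⟩ := exists_ne a
  refine ⟨Matrix.single c a (1 : R), 2, ?_, ?_⟩
  · have h2 : (Matrix.single c a (1 : R)) ^ 2 = 0 := by
      rw [pow_two]
      exact Matrix.single_mul_single_of_ne _ _ _ _ hc.symm _
    rw [h2]
    exact Module.zero_smul K
  · intro h
    apply hab
    have h1 := congrFun (congrFun h c) b
    rw [Matrix.moduleSMul_apply, Finset.sum_eq_single a] at h1
    · simpa using h1
    · intro k _ hk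
      rw [Matrix.single_apply_of_col_ne _ _ hk.symm, Module.zero_smul]
    · intro hh
      exact absurd (Finset.mem_univ a) hh
end

section
/- Let R be a ring, M a left R-module, and n ≥ 2 a natural number. Then Matrix (Fin n) (Fin n) M, with the Matrix (Fin n) (Fin n) R-module structure given by (A • K) i j = ∑_k A i k • K k j, is a nil-semicommutative module. -/
/-- A left `R`-module `M` is nil-semicommutative if whenever `a • m` is a nilpotent element
of `M`, so is `a • r • m` for every `r : R`. -/
def IsNilSemicommutative (R M : Type*) [Ring R] [AddCommGroup M] [Module R M] : Prop :=
  ∀ (a : R) (m : M), IsNilElem R (a • m) → ∀ r : R, IsNilElem R (a • r • m)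

theorem matrix_isNilElem_all {n : ℕ} {R M : Type*} [Ring R] [AddCommGroup M]
    [Module R M] (hn : 2 ≤ n) (K : Matrix (Fin n) (Fin n) M) :
    IsNilElem (Matrix (Fin n) (Fin n) R) K := by
  by_cases hK : K = 0
  · exact Or.inl hK
  right
  have : ∃ p q, K p q ≠ 0 := by
    by_contra! h
    exact hK (Matrix.ext h)
  obtain ⟨p, q, hpq⟩ := this
  haveI : Nontrivial (Fin n) := Fin.nontrivial_iff_two_le.mpr hn
  obtain ⟨i, hi⟩ := exists_ne p
  refine ⟨Matrix.single i p 1, 2, ?_, ?_⟩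
  · have h2 : (Matrix.single i p (1 : R)) ^ 2 = 0 := by
      rw [pow_two, Matrix.single_mul_single_of_ne]
      exact hi.symm
    rw [h2]
    exact Module.zero_smul K
  · intro h
    apply hpq
    have h3 := congrFun (congrFun h i) q
    rw [Matrix.moduleSMul_apply] at h3
    simpa [Matrix.single_apply, ite_smul] using h3

theorem matrix_module_nilSemicommutative {n : ℕ} {R M : Type*} [Ring R] [AddCommGroup M]
    [Module R M] (hn : 2 ≤ n) :
    IsNilSemicommutative (Matrix (Fin n) (Fin n) R) (Matrix (Fin n) (Fin n) M) := by
  intro a m _ r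
  exact matrix_isNilElem_all hn _
end

section
/- Let R be a ring, M a left R-module containing a nonzero element, and n ≥ 4 a natural number. Then Matrix (Fin n) (Fin n) M, with the Matrix (Fin n) (Fin n) R-module structure given by (A • K) i j = ∑_k A i k • K k j, is not a semicommutative module: there exist A ∈ Matrix (Fin n) (Fin n) R and K ∈ Matrix (Fin n) (Fin n) M with A • K = 0 but A • (L • K) ≠ 0 for some L ∈ Matrix (Fin n) (Fin n) R. -/
theorem matrix_module_not_semicommutative {n : ℕ} {R M : Type*} [Ring R] [AddCommGroup M]
    [Module R M] (hn : 4 ≤ n) (hM : ∃ m : M, m ≠ 0) :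
    ∃ (A : Matrix (Fin n) (Fin n) R) (K : Matrix (Fin n) (Fin n) M),
      A • K = 0 ∧ ∃ L : Matrix (Fin n) (Fin n) R, A • (L • K) ≠ 0 := by
  obtain ⟨m, hm⟩ := hM
  let a : Fin n := ⟨0, by omega⟩
  let b : Fin n := ⟨1, by omega⟩
  have hab : a ≠ b := by simp [a, b]
  refine ⟨fun i k => if i = a ∧ k = a then 1 else 0,
    fun i j => if i = b ∧ j = b then m else 0, ?_,
    fun i j => if i = a ∧ j = b then 1 else 0, ?_⟩
  · ext i j
    refine (Matrix.moduleSMul_apply _ _ i j).trans ?_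
    refine Finset.sum_eq_zero fun k _ => ?_
    by_cases hk : k = a
    · simp [hk, hab]
    · simp [hk]
  · intro h
    apply hm
    have h1 : (∑ k : Fin n, (if a = a ∧ k = a then (1 : R) else 0) •
        ∑ l : Fin n, (if k = a ∧ l = b then (1 : R) else 0) •
          (if l = b ∧ b = b then m else 0)) = 0 := congrFun (congrFun h a) b
    simpa [ite_smul] using h1
end
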